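/- arXiv:2011.10890 — 4 statements merged into one kernel-verified Lean document; each statement's English description precedes it below -/
import Mathlib

section
/- Let 𝒳 be a countable type and N a positive natural number. A function f : (Fin N → 𝒳) → ℝ is permutation invariant, i.e. f(x ∘ σ) = f(x) for every x : Fin N → 𝒳 and every permutation σ of Fin N, if and only if there exist functions φ : 𝒳 → ℝ and ρ : ℝ → ℝ such that f(x) = ρ(∑_{i : Fin N} φ(x i)) for all x. -/
/-- Powers of a transcendental number separate multisets of exponents: equal sums force equal
tuples up to reindexing. -/
theorem exists_perm_comp_eq_of_sum_transcendental_pow_eq {ι : Type*} [Fintype ι] {t : ℝ}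
    (ht : Transcendental ℤ t) {a b : ι → ℕ} (h : ∑ i, t ^ a i = ∑ i, t ^ b i) :
    ∃ σ : Equiv.Perm ι, b ∘ σ = a := by
  classical
  have hpoly : (∑ i, Polynomial.X ^ a i : Polynomial ℤ) = ∑ i, Polynomial.X ^ b i :=
    transcendental_iff_injective.mp ht (by simpa using h)
  have hcard (n : ℕ) : Fintype.card {i // a i = n} = Fintype.card {i // b i = n} := by
    have hn := congrArg (fun p ↦ p.coeff n) hpoly
    simp only [Polynomial.finsetSum_coeff, Polynomial.coeff_X_pow, Finset.sum_boole,
      eq_comm (a := n)] at hn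
    simpa only [Fintype.card_subtype, Nat.cast_inj] using hn
  exact ⟨Equiv.ofFiberEquiv fun n ↦ Fintype.equivOfCardEq (hcard n),
    funext fun i ↦ Equiv.ofFiberEquiv_map _ i⟩


/-- Deep Sets decomposition theorem (countable universe): a function
`f : (Fin N → 𝒳) → ℝ` is permutation invariant iff it decomposes as
`f x = ρ (∑ i, φ (x i))` for some `φ : 𝒳 → ℝ` and `ρ : ℝ → ℝ`. -/
theorem deep_sets_invariant_iff_sum_decomposition
    {𝒳 : Type*} [Countable 𝒳] (N : ℕ) (hN : 0 < N)
    (f : (Fin N → 𝒳) → ℝ) :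
    (∀ (x : Fin N → 𝒳) (σ : Equiv.Perm (Fin N)), f (x ∘ σ) = f x) ↔
      ∃ (φ : 𝒳 → ℝ) (ρ : ℝ → ℝ), ∀ x : Fin N → 𝒳, f x = ρ (∑ i, φ (x i)) := by
  constructor
  · intro hf
    obtain ⟨e, he⟩ := exists_injective_nat 𝒳
    have ht : Transcendental ℤ (liouvilleNumber 2) := transcendental_liouvilleNumber le_rfl
    let S (x : Fin N → 𝒳) : ℝ := ∑ i, liouvilleNumber 2 ^ e (x i)
    have hS : f.FactorsThrough S := by
      intro x y hxy
      obtain ⟨σ, hσ⟩ := exists_perm_comp_eq_of_sum_transcendental_pow_eq ht hxy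
      rw [← hf y σ]
      exact congrArg f (funext fun i ↦ he (congrFun hσ i).symm)
    obtain ⟨ρ, hρ⟩ := (Function.factorsThrough_iff f).mp hS
    exact ⟨fun a ↦ liouvilleNumber 2 ^ e a, ρ, congrFun hρ⟩
  · rintro ⟨φ, ρ, hf⟩ x σ
    rw [hf, hf]
    exact congrArg ρ (Equiv.sum_comp σ fun i ↦ φ (x i))
end

section
/- Let N ≥ 2, let a, q, ε, c, T be real numbers with T > 0 and R := (a+q)² + (1 − 1/N²)(ε − q²) > 0, and set δ± := −(a+q) ± √R. Define E(t) := exp((δ⁺ − δ⁻)(T − t)), numerator n(t) := −(ε − q²)(E(t) − 1) − c(δ⁺E(t) − δ⁻), denominator D(t) := (δ⁻E(t) − δ⁺) − c(1 − 1/N²)(E(t) − 1), and η(t) := n(t)/D(t). Assume D(t) ≠ 0 for all t ∈ [0,T]. Then η is differentiable on [0,T], satisfies the Riccati equation η̇(t) = 2(a+q)η(t) + (1 − 1/N²)η(t)² − (ε − q²) for all t ∈ [0,T], and satisfies the terminal condition η(T) = c. -/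
/-- A quotient of two affine functions of `exp (2 s (T - t))` solves a Riccati equation with
constant coefficients whose quarter discriminant is `s ^ 2`. -/
theorem hasDerivAt_riccati_quotient {A k e c s T t : ℝ} (hs : s ^ 2 = A ^ 2 + k * e)
    {n D : ℝ → ℝ}
    (hn : n = fun t => -e * (Real.exp (((-A + s) - (-A - s)) * (T - t)) - 1) -
      c * ((-A + s) * Real.exp (((-A + s) - (-A - s)) * (T - t)) - (-A - s)))
    (hD : D = fun t => ((-A - s) * Real.exp (((-A + s) - (-A - s)) * (T - t)) - (-A + s)) -
      c * k * (Real.exp (((-A + s) - (-A - s)) * (T - t)) - 1))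
    (h : D t ≠ 0) :
    HasDerivAt (fun t => n t / D t)
      (2 * A * (n t / D t) + k * (n t / D t) ^ 2 - e) t := by
  have hE : HasDerivAt (fun t => Real.exp (((-A + s) - (-A - s)) * (T - t)))
      (Real.exp (((-A + s) - (-A - s)) * (T - t)) * (((-A + s) - (-A - s)) * (-1))) t :=
    (((hasDerivAt_id t).const_sub T).const_mul _).exp
  have hn' := ((hE.sub_const 1).const_mul (-e)).sub
    (((hE.const_mul (-A + s)).sub_const (-A - s)).const_mul c)
  have hD' := ((hE.const_mul (-A - s)).sub_const (-A + s)).sub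
    ((hE.sub_const 1).const_mul (c * k))
  have hq := (hn'.congr_of_eventuallyEq (.of_eq hn)).div
    (hD'.congr_of_eventuallyEq (.of_eq hD)) h
  refine hq.congr_deriv ?_
  have hnt := congrFun hn t
  have hDt := congrFun hD t
  generalize Real.exp (((-A + s) - (-A - s)) * (T - t)) = E at hnt hDt ⊢
  field_simp
  rw [hnt, hDt]
  grind

/-- The closed-form expression `η(t) = n(t)/D(t)` solves the Riccati equation
`η̇ = 2(a+q)η + (1 − 1/N²)η² − (ε − q²)` on `[0,T]` with terminal condition
`η(T) = c`, provided the denominator `D` does not vanish on `[0,T]`. -/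
theorem riccati_closed_form_solution
    (N : ℕ) (hN : 2 ≤ N) (a q ε c T : ℝ) (hT : 0 < T)
    (hR : 0 < (a + q) ^ 2 + (1 - 1 / (N : ℝ) ^ 2) * (ε - q ^ 2)) :
    let R : ℝ := (a + q) ^ 2 + (1 - 1 / (N : ℝ) ^ 2) * (ε - q ^ 2)
    let δp : ℝ := -(a + q) + Real.sqrt R
    let δm : ℝ := -(a + q) - Real.sqrt R
    let E : ℝ → ℝ := fun t => Real.exp ((δp - δm) * (T - t))
    let n : ℝ → ℝ := fun t => -(ε - q ^ 2) * (E t - 1) - c * (δp * E t - δm)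
    let D : ℝ → ℝ := fun t =>
      (δm * E t - δp) - c * (1 - 1 / (N : ℝ) ^ 2) * (E t - 1)
    let η : ℝ → ℝ := fun t => n t / D t
    (∀ t ∈ Set.Icc (0 : ℝ) T, D t ≠ 0) →
      (∀ t ∈ Set.Icc (0 : ℝ) T,
          DifferentiableAt ℝ η t ∧
            deriv η t =
              2 * (a + q) * η t + (1 - 1 / (N : ℝ) ^ 2) * η t ^ 2 -
                (ε - q ^ 2)) ∧
        η T = c := by
  intro R δp δm E n D η hD
  have hs : Real.sqrt R ^ 2 = (a + q) ^ 2 + (1 - 1 / (N : ℝ) ^ 2) * (ε - q ^ 2) :=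
    Real.sq_sqrt hR.le
  refine ⟨fun t ht => ?_, ?_⟩
  · have h := hasDerivAt_riccati_quotient (n := n) (D := D) hs rfl rfl (hD t ht)
    exact ⟨h.differentiableAt, h.deriv⟩
  · have hE : E T = 1 := by simp [E]
    have hDT : D T = δm - δp := by simp only [D, hE]; ring
    have hnT : n T = c * D T := by rw [hDT]; simp only [n, hE]; ring
    exact (div_eq_iff (hD T ⟨hT.le, le_rfl⟩)).2 hnT
end

section
/- Let N ≥ 2, let a, q, ε, c, σ, ρ, T be real numbers with T > 0 and ρ² ≤ 1, and fix i ∈ {1,…,N}. Suppose η : ℝ → ℝ is differentiable on [0,T] with η̇(t) = 2(a+q)η(t) + (1 − 1/N²)η(t)² − (ε − q²) and η(T) = c, and μ : ℝ → ℝ is differentiable on [0,T] with μ̇(t) = −(1/2)σ²(1−ρ²)(1−1/N)η(t) and μ(T) = 0. For x ∈ ℝᴺ write x̄ = (1/N)∑_{j=1}^N x_j, define V(t,x) = (η(t)/2)(x̄ − x_i)² + μ(t), define controls u_j(t,x) = (q + η(t)(1 − 1/N))(x̄ − x_j) for j ≠ i, and set A_{jk} = σ²ρ² + σ²(1−ρ²)δ_{jk}.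 Then for every t ∈ [0,T] and x ∈ ℝᴺ the HJB equation holds: ∂_t V + (1/2)∑_{j,k=1}^N A_{jk} ∂²V/∂x_j∂x_k + a(x̄ − x_i)·∂V/∂x_i + ∑_{j≠i} [a(x̄ − x_j) + u_j(t,x)]·∂V/∂x_j + (ε/2)(x̄ − x_i)² − (1/2)(q(x̄ − x_i) − ∂V/∂x_i)² = 0, and the terminal condition V(T,x) = (c/2)(x̄ − x_i)² holds. -/
/-- A quadratic function of a continuous linear functional has derivative `h * L y * L v`. -/
lemma fderiv_half_mul_sq_add_const {E : Type*} [NormedAddCommGroup E] [NormedSpace ℝ E]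
    (L : E →L[ℝ] ℝ) (h m : ℝ) (y v : E) :
    fderiv ℝ (fun z => h / 2 * L z ^ 2 + m) y v = h * L y * L v := by
  have H := (((L.hasFDerivAt (x := y)).pow 2).const_mul (h / 2)).add_const m
  rw [H.fderiv]
  simp
  ring

/-- The derivative of `z ↦ h * L z * r` in direction `v` is `h * L v * r`. -/
lemma fderiv_const_mul_mul_const {E : Type*} [NormedAddCommGroup E] [NormedSpace ℝ E]
    (L : E →L[ℝ] ℝ) (h r : ℝ) (y v : E) :
    fderiv ℝ (fun z => h * L z * r) y v = h * L v * r := by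
  have H := ((L.hasFDerivAt (x := y)).const_mul h).mul_const r
  rw [H.fderiv]
  simp
  ring

/-- The deviation of the mean from the `i`-th coordinate, as a continuous linear functional. -/
noncomputable def meanDeviation (N : ℕ) (i : Fin N) : (Fin N → ℝ) →L[ℝ] ℝ :=
  (N : ℝ)⁻¹ • (∑ j, ContinuousLinearMap.proj j) - ContinuousLinearMap.proj i

lemma meanDeviation_apply (N : ℕ) (i : Fin N) (x : Fin N → ℝ) :
    meanDeviation N i x = (∑ j, x j) / N - x i := by
  simp [meanDeviation]
  ring

lemma meanDeviation_single (N : ℕ) (i j : Fin N) :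
    meanDeviation N i (Pi.single j 1) = 1 / (N : ℝ) - if j = i then 1 else 0 := by
  simp [meanDeviation_apply, Pi.single_apply, eq_comm]

lemma sum_meanDeviation_single {N : ℕ} (hN : (N : ℝ) ≠ 0) (i : Fin N) :
    ∑ j, meanDeviation N i (Pi.single j 1) = 0 := by
  simp [meanDeviation_single, hN]

lemma sum_meanDeviation_single_sq {N : ℕ} (hN : (N : ℝ) ≠ 0) (i : Fin N) :
    ∑ j, meanDeviation N i (Pi.single j 1) ^ 2 = 1 - 1 / (N : ℝ) := by
  have h : ∀ j, meanDeviation N i (Pi.single j 1) ^ 2 =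
      1 / (N : ℝ) ^ 2 + (1 - 2 / N) * if j = i then 1 else 0 := by
    intro j
    rw [meanDeviation_single]
    split_ifs <;> ring
  simp only [h, Finset.sum_add_distrib, ← Finset.mul_sum]
  simp
  field_simp
  ring

/-- The deviations from the mean sum to zero. -/
lemma sum_meanDeviation {N : ℕ} (hN : (N : ℝ) ≠ 0) (x : Fin N → ℝ) :
    ∑ j, meanDeviation N j x = 0 := by
  simp only [meanDeviation_apply, Finset.sum_sub_distrib]
  simp
  field_simp
  ring

/-- A quadratic form with equicorrelated coefficients, evaluated at a rank-one matrix. -/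
lemma sum_sum_equicorrelated {ι : Type*} [Fintype ι] [DecidableEq ι] (b s h : ℝ) (d : ι → ℝ) :
    ∑ j, ∑ k, (b + s * if j = k then 1 else 0) * (h * d k * d j) =
      h * (b * (∑ j, d j) ^ 2 + s * ∑ j, d j ^ 2) := by
  simp only [add_mul, Finset.sum_add_distrib, mul_ite, ite_mul, mul_one, mul_zero, zero_mul,
    Finset.sum_ite_eq, Finset.mem_univ, if_true]
  rw [sq (∑ j, d j), Finset.sum_mul_sum, mul_add]
  simp only [Finset.mul_sum]
  congr 1
  · exact Finset.sum_congr rfl fun j _ => Finset.sum_congr rfl fun k _ => by ring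
  · exact Finset.sum_congr rfl fun j _ => by ring


/-- Verification of the inter-bank HJB equation for the analytical ansatz
`V(t,x) = (η(t)/2)(x̄ − x_i)² + μ(t)`, where `η` solves the Riccati ODE with
`η(T) = c` and `μ̇ = −(1/2)σ²(1−ρ²)(1−1/N)η` with `μ(T) = 0`, the other players
using the optimal feedback controls `u_j = (q + η(1 − 1/N))(x̄ − x_j)`. -/
theorem interbank_hjb_verification
    (N : ℕ) (hN : 2 ≤ N) (a q ε c σ ρ T : ℝ) (hT : 0 < T) (hρ : ρ ^ 2 ≤ 1)
    (i : Fin N) (η μ : ℝ → ℝ)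
    (hη : ∀ t ∈ Set.Icc (0 : ℝ) T, DifferentiableAt ℝ η t ∧
      deriv η t = 2 * (a + q) * η t + (1 - 1 / (N : ℝ) ^ 2) * η t ^ 2 -
        (ε - q ^ 2))
    (hηT : η T = c)
    (hμ : ∀ t ∈ Set.Icc (0 : ℝ) T, DifferentiableAt ℝ μ t ∧
      deriv μ t = -(1 / 2) * σ ^ 2 * (1 - ρ ^ 2) * (1 - 1 / (N : ℝ)) * η t)
    (hμT : μ T = 0) :
    let xbar : (Fin N → ℝ) → ℝ := fun x => (∑ j, x j) / N
    let V : ℝ → (Fin N → ℝ) → ℝ := fun t x =>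
      (η t / 2) * (xbar x - x i) ^ 2 + μ t
    let u : ℝ → (Fin N → ℝ) → Fin N → ℝ := fun t x j =>
      (q + η t * (1 - 1 / (N : ℝ))) * (xbar x - x j)
    let A : Fin N → Fin N → ℝ := fun j k =>
      σ ^ 2 * ρ ^ 2 + σ ^ 2 * (1 - ρ ^ 2) * (if j = k then 1 else 0)
    let Vx : ℝ → (Fin N → ℝ) → Fin N → ℝ := fun t x j =>
      fderiv ℝ (V t) x (Pi.single j 1)
    let Vxx : ℝ → (Fin N → ℝ) → Fin N → Fin N → ℝ := fun t x j k =>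
      fderiv ℝ (fun y => fderiv ℝ (V t) y (Pi.single j 1)) x (Pi.single k 1)
    (∀ t ∈ Set.Icc (0 : ℝ) T, ∀ x : Fin N → ℝ,
        deriv (fun s => V s x) t +
          (1 / 2) * ∑ j, ∑ k, A j k * Vxx t x j k +
          a * (xbar x - x i) * Vx t x i +
          (∑ j ∈ Finset.univ.filter (fun j => j ≠ i),
            (a * (xbar x - x j) + u t x j) * Vx t x j) +
          (ε / 2) * (xbar x - x i) ^ 2 -
          (1 / 2) * (q * (xbar x - x i) - Vx t x i) ^ 2 = 0) ∧
      (∀ x : Fin N → ℝ, V T x = (c / 2) * (xbar x - x i) ^ 2) := by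
  intro xbar V u A Vx Vxx
  have hN0 : (N : ℝ) ≠ 0 := by
    have : N ≠ 0 := by omega
    exact_mod_cast this
  have hdev : ∀ x j, xbar x - x j = meanDeviation N j x := fun x j =>
    (meanDeviation_apply N j x).symm
  have hV : ∀ t, V t = fun x => η t / 2 * meanDeviation N i x ^ 2 + μ t := fun t => by
    funext x
    simp only [V, hdev]
  have hVx : ∀ t x j, Vx t x j =
      η t * meanDeviation N i x * meanDeviation N i (Pi.single j 1) := fun t x j => by
    simp only [Vx, hV, fderiv_half_mul_sq_add_const]
  have hVxx : ∀ t x j k, Vxx t x j k =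
      η t * meanDeviation N i (Pi.single k 1) * meanDeviation N i (Pi.single j 1) :=
    fun t x j k => by
      simp only [Vxx, hV, fderiv_half_mul_sq_add_const, fderiv_const_mul_mul_const]
  refine ⟨fun t ht x => ?_, fun x => by simp [V, hηT, hμT]⟩
  obtain ⟨hηd, hη'⟩ := hη t ht
  obtain ⟨hμd, hμ'⟩ := hμ t ht
  have hVt : deriv (fun s => V s x) t =
      deriv η t / 2 * meanDeviation N i x ^ 2 + deriv μ t := by
    simp only [hV]
    exact (((hηd.hasDerivAt.div_const 2).mul_const _).add hμd.hasDerivAt).deriv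
  have hdiff : ∑ j, ∑ k, A j k * Vxx t x j k =
      η t * (σ ^ 2 * (1 - ρ ^ 2) * (1 - 1 / (N : ℝ))) := by
    simp only [A, hVxx]
    rw [sum_sum_equicorrelated, sum_meanDeviation_single hN0, sum_meanDeviation_single_sq hN0]
    ring
  have hdrift : ∑ j ∈ Finset.univ.filter (fun j => j ≠ i),
      (a * (xbar x - x j) + u t x j) * Vx t x j =
      -((a + q + η t * (1 - 1 / (N : ℝ))) * η t * meanDeviation N i x ^ 2 / N) := by
    have hsum : ∑ j ∈ Finset.univ.filter (fun j => j ≠ i), meanDeviation N j x =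
        -meanDeviation N i x := by
      rw [Finset.filter_ne', eq_neg_iff_add_eq_zero, Finset.sum_erase_add _ _ (Finset.mem_univ i)]
      exact sum_meanDeviation hN0 x
    calc _ = ∑ j ∈ Finset.univ.filter (fun j => j ≠ i),
          (a + q + η t * (1 - 1 / (N : ℝ))) * η t * meanDeviation N i x / N *
            meanDeviation N j x := by
          refine Finset.sum_congr rfl fun j hj => ?_
          simp only [u, hdev, hVx, meanDeviation_single, if_neg (Finset.mem_filter.mp hj).2]
          ring
      _ = _ := by
          rw [← Finset.mul_sum, hsum]
          ring
  rw [hVt, hdiff, hdrift, hVx, hdev, meanDeviation_single, if_pos rfl, hη', hμ']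
  field_simp
  ring
end

section
/- Let 0 ≤ t₀ < T and let ξ, H_z, H_x, g_x, D be strictly positive real numbers. Suppose a, b : [t₀, T] → ℝ are continuous and nonnegative, a(t) ≤ D·e^{ξ(t − t₀)} for all t ∈ [t₀, T], and b satisfies the backward integral inequality b(t) ≤ g_x·a(T) + ∫_t^T (H_z·b(s) + H_z⁻¹·H_x·a(s)) ds for all t ∈ [t₀, T]. Then b(t₀) ≤ e^{H_z(T − t₀)}·[g_x·e^{ξ(T − t₀)} + (H_x/(H_z·ξ))·(e^{ξ(T − t₀)} − 1)]·D. -/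
/-- **Backward Gronwall inequality** in integral form, with a constant rate. -/
theorem le_mul_exp_of_le_add_integral_right {K C a b : ℝ} {f : ℝ → ℝ} (hab : a ≤ b) (hK : 0 ≤ K)
    (hf : ContinuousOn f (Set.Icc a b))
    (hle : ∀ t ∈ Set.Icc a b, f t ≤ C + K * ∫ s in t..b, f s) :
    f a ≤ C * Real.exp (K * (b - a)) := by
  have hmono : MonotoneOn (fun t ↦ Real.exp (K * t) * (C + K * ∫ s in t..b, f s))
      (Set.Icc a b) := by
    have hderiv : ∀ t ∈ interior (Set.Icc a b),
        HasDerivAt (fun t ↦ Real.exp (K * t) * (C + K * ∫ s in t..b, f s))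
          (Real.exp (K * t) * (K * 1) * (C + K * ∫ s in t..b, f s) +
            Real.exp (K * t) * (K * -f t)) t := by
      intro t ht
      rw [interior_Icc] at ht
      have hint : IntervalIntegrable f MeasureTheory.volume t b :=
        (hf.mono (Set.Icc_subset_Icc_left ht.1.le)).intervalIntegrable_of_Icc ht.2.le
      have hI := intervalIntegral.integral_hasDerivAt_left hint
        ((hf.mono Set.Ioo_subset_Icc_self).stronglyMeasurableAtFilter isOpen_Ioo t ht)
        (hf.continuousAt (Icc_mem_nhds ht.1 ht.2))
      exact (((hasDerivAt_id t).const_mul K).exp).mul ((hI.const_mul K).const_add C)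
    refine monotoneOn_of_deriv_nonneg (convex_Icc a b) ?_
      (fun t ht ↦ (hderiv t ht).differentiableAt.differentiableWithinAt) ?_
    · have hI : ContinuousOn (fun t ↦ ∫ s in t..b, f s) (Set.Icc a b) := by
        have := intervalIntegral.continuousOn_primitive_interval_left (μ := MeasureTheory.volume)
          (f := f) (a := a) (b := b) (by
            rw [Set.uIcc_of_le hab]
            exact hf.integrableOn_Icc)
        rwa [Set.uIcc_of_le hab] at this
      fun_prop
    · intro t ht
      rw [(hderiv t ht).deriv]
      have h := sub_nonneg.2 (hle t (interior_subset ht))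
      calc 0 ≤ Real.exp (K * t) * K * (C + K * (∫ s in t..b, f s) - f t) := by positivity
        _ = _ := by ring
  have hends := hmono (Set.left_mem_Icc.2 hab) (Set.right_mem_Icc.2 hab) hab
  simp only [intervalIntegral.integral_same, mul_zero, add_zero] at hends
  refine (hle a (Set.left_mem_Icc.2 hab)).trans ?_
  rw [mul_sub, Real.exp_sub, ← mul_div_assoc, le_div_iff₀ (Real.exp_pos _)]
  linarith

theorem integral_exp_mul_sub {c : ℝ} (hc : c ≠ 0) (a b : ℝ) :
    ∫ s in a..b, Real.exp (c * (s - a)) = (Real.exp (c * (b - a)) - 1) / c := by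
  have hderiv : ∀ s ∈ Set.uIcc a b,
      HasDerivAt (fun s ↦ Real.exp (c * (s - a)) / c) (Real.exp (c * (s - a))) s := by
    intro s _
    have h := ((((hasDerivAt_id s).sub_const a).const_mul c).exp).div_const c
    simpa [hc] using h
  rw [intervalIntegral.integral_eq_sub_of_hasDerivAt hderiv
    (Continuous.intervalIntegrable (by fun_prop) a b)]
  simp [sub_div]

/-- Deterministic core of Lemma 1: if `a t ≤ D e^{ξ(t−t₀)}` on `[t₀,T]` and `b`
satisfies the backward integral inequality
`b t ≤ g_x a T + ∫_t^T (H_z b s + H_z⁻¹ H_x a s) ds`, then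
`b t₀ ≤ e^{H_z(T−t₀)}[g_x e^{ξ(T−t₀)} + (H_x/(H_z ξ))(e^{ξ(T−t₀)} − 1)] D`. -/
theorem backward_gronwall_value_spread_bound
    (t₀ T ξ Hz Hx gx D : ℝ) (ht₀ : 0 ≤ t₀) (htT : t₀ < T)
    (hξ : 0 < ξ) (hHz : 0 < Hz) (hHx : 0 < Hx) (hgx : 0 < gx) (hD : 0 < D)
    (a b : ℝ → ℝ)
    (ha_cont : ContinuousOn a (Set.Icc t₀ T))
    (hb_cont : ContinuousOn b (Set.Icc t₀ T))
    (ha_nonneg : ∀ t ∈ Set.Icc t₀ T, 0 ≤ a t)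
    (hb_nonneg : ∀ t ∈ Set.Icc t₀ T, 0 ≤ b t)
    (ha : ∀ t ∈ Set.Icc t₀ T, a t ≤ D * Real.exp (ξ * (t - t₀)))
    (hb : ∀ t ∈ Set.Icc t₀ T,
      b t ≤ gx * a T + ∫ s in t..T, (Hz * b s + Hz⁻¹ * Hx * a s)) :
    b t₀ ≤
      Real.exp (Hz * (T - t₀)) *
        (gx * Real.exp (ξ * (T - t₀)) +
          (Hx / (Hz * ξ)) * (Real.exp (ξ * (T - t₀)) - 1)) * D := by
  have hle := htT.le
  have hTmem : T ∈ Set.Icc t₀ T := Set.right_mem_Icc.2 hle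
  have ha_int : IntervalIntegrable a MeasureTheory.volume t₀ T :=
    ha_cont.intervalIntegrable_of_Icc hle
  have ha_integral : ∫ s in t₀..T, a s ≤ D * ((Real.exp (ξ * (T - t₀)) - 1) / ξ) := by
    rw [← integral_exp_mul_sub hξ.ne', ← intervalIntegral.integral_const_mul]
    exact intervalIntegral.integral_mono_on hle ha_int
      (Continuous.intervalIntegrable (by fun_prop) t₀ T) ha
  have hgronwall := le_mul_exp_of_le_add_integral_right
    (C := gx * a T + Hz⁻¹ * Hx * ∫ s in t₀..T, a s) hle hHz.le hb_cont (by
      intro t ht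
      have hsub : Set.Icc t T ⊆ Set.Icc t₀ T := Set.Icc_subset_Icc_left ht.1
      have hat := (ha_cont.mono hsub).intervalIntegrable_of_Icc (μ := MeasureTheory.volume) ht.2
      have hbt := (hb_cont.mono hsub).intervalIntegrable_of_Icc (μ := MeasureTheory.volume) ht.2
      have hat₀ := (ha_cont.mono (Set.Icc_subset_Icc_right ht.2)).intervalIntegrable_of_Icc
        (μ := MeasureTheory.volume) ht.1
      have hmono : ∫ s in t..T, a s ≤ ∫ s in t₀..T, a s := by
        rw [← intervalIntegral.integral_add_adjacent_intervals hat₀ hat]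
        exact le_add_of_nonneg_left (intervalIntegral.integral_nonneg ht.1
          fun s hs ↦ ha_nonneg s ⟨hs.1, hs.2.trans ht.2⟩)
      have hscaled := mul_le_mul_of_nonneg_left hmono (by positivity : 0 ≤ Hz⁻¹ * Hx)
      have h := hb t ht
      rw [intervalIntegral.integral_add (hbt.const_mul _) (hat.const_mul _),
        intervalIntegral.integral_const_mul, intervalIntegral.integral_const_mul] at h
      linarith)
  calc b t₀ ≤ (gx * a T + Hz⁻¹ * Hx * ∫ s in t₀..T, a s) * Real.exp (Hz * (T - t₀)) := hgronwall
    _ ≤ (gx * (D * Real.exp (ξ * (T - t₀))) +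
          Hz⁻¹ * Hx * (D * ((Real.exp (ξ * (T - t₀)) - 1) / ξ))) * Real.exp (Hz * (T - t₀)) := by
        gcongr
        exact ha T hTmem
    _ = _ := by
        field_simp
end
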